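/- arXiv:2603.21945 — 7 statements merged into one kernel-verified Lean document; each statement's English description precedes it below -/
import Mathlib

section
/- Let γ ∈ SL₂(ℤ) be hyperbolic. An integral binary quadratic form F(X₁,X₂) = AX₁² + BX₁X₂ + CX₂² (A, B, C ∈ ℤ) satisfies γ·F = F if and only if F is an integer multiple of Q_γ. In particular, any γ-invariant integral binary quadratic form with gcd(A,B,C) = 1 equals Q_γ or −Q_γ. -/
open Matrix MvPolynomial

/-- `SL₂(ℤ)`. -/
abbrev SL2Z := Matrix.SpecialLinearGroup (Fin 2) ℤ

/-- The left action of a matrix `γ = (a b; c d)` on polynomials in `X₁ = X 0` and `X₂ = X 1`: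
`(γ · P)(X₁, X₂) = P (d X₁ - b X₂, -c X₁ + a X₂)`. -/
noncomputable def matAct (γ : Matrix (Fin 2) (Fin 2) ℤ) :
    MvPolynomial (Fin 2) ℤ →ₐ[ℤ] MvPolynomial (Fin 2) ℤ :=
  bind₁ ![C (γ 1 1) * X 0 - C (γ 0 1) * X 1, -(C (γ 1 0)) * X 0 + C (γ 0 0) * X 1]

/-- The binary quadratic form `Q_γ = -(sgn (a+d) / gcd (c, a-d, b)) * (c X₁² - (a-d) X₁X₂ - b X₂²)`
attached to `γ = (a b; c d) ∈ SL₂(ℤ)`. -/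
noncomputable def Qform (γ : SL2Z) : MvPolynomial (Fin 2) ℤ :=
  let a : ℤ := γ.1 0 0
  let b : ℤ := γ.1 0 1
  let c : ℤ := γ.1 1 0
  let d : ℤ := γ.1 1 1
  let g : ℤ := (Int.gcd (Int.gcd c (a - d) : ℤ) b : ℤ)
  C (-(a + d).sign) *
    (C (c / g) * X 0 ^ 2 - C ((a - d) / g) * (X 0 * X 1) - C (b / g) * X 1 ^ 2)


/-- A matrix in `SL₂(ℤ)` is hyperbolic if `|trace| > 2`. -/
def IsHyperbolic (γ : SL2Z) : Prop := 2 < |γ.1 0 0 + γ.1 1 1|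

/-- A matrix in `SL₂(ℤ)` is parabolic if `|trace| = 2` and `γ ≠ ±1`. -/
def IsParabolic (γ : SL2Z) : Prop := |γ.1 0 0 + γ.1 1 1| = 2 ∧ γ ≠ 1 ∧ γ ≠ -1

theorem coeffs_eq_of_quadratic_eq {A B C' A' B' D' : ℤ}
    (h : (C A * X 0 ^ 2 + C B * (X 0 * X 1) + C C' * X 1 ^ 2 : MvPolynomial (Fin 2) ℤ) =
      C A' * X 0 ^ 2 + C B' * (X 0 * X 1) + C D' * X 1 ^ 2) :
    A = A' ∧ B = B' ∧ C' = D' := by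
  have h₁ := congrArg (eval ![1, 0]) h
  have h₂ := congrArg (eval ![0, 1]) h
  have h₃ := congrArg (eval ![1, 1]) h
  simp at h₁ h₂ h₃
  exact ⟨h₁, by linarith, h₂⟩

theorem matAct_quadratic (M : Matrix (Fin 2) (Fin 2) ℤ) (A B C' : ℤ) :
    matAct M (C A * X 0 ^ 2 + C B * (X 0 * X 1) + C C' * X 1 ^ 2) =
      C (A * M 1 1 ^ 2 - B * (M 1 1 * M 1 0) + C' * M 1 0 ^ 2) * X 0 ^ 2 +
      C (-2 * A * M 0 1 * M 1 1 + B * (M 0 0 * M 1 1 + M 0 1 * M 1 0)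
        - 2 * C' * M 0 0 * M 1 0) * (X 0 * X 1) +
      C (A * M 0 1 ^ 2 - B * (M 0 0 * M 0 1) + C' * M 0 0 ^ 2) * X 1 ^ 2 := by
  have hC (z : ℤ) : bind₁ ![C (M 1 1) * X 0 - C (M 0 1) * X 1,
      -(C (M 1 0)) * X 0 + C (M 0 0) * X 1] (C z) = (C z : MvPolynomial (Fin 2) ℤ) :=
    bind₁_C_right _ _
  simp only [matAct, map_add, map_mul, map_pow, hC, bind₁_X_right, Matrix.cons_val_zero,
    Matrix.cons_val_one, map_sub, map_neg, map_ofNat]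
  ring

/-- Invariance of a form under a matrix of determinant one is a system of linear equations. -/
theorem invariant_iff_proportional {a b c d A B C' : ℤ} (hdet : a * d - b * c = 1) :
    (A * d ^ 2 - B * (d * c) + C' * c ^ 2 = A ∧
      -2 * A * b * d + B * (a * d + b * c) - 2 * C' * a * c = B ∧
      A * b ^ 2 - B * (a * b) + C' * a ^ 2 = C') ↔
    (A * (a - d) = -(B * c) ∧ A * b = -(C' * c) ∧ B * b = C' * (a - d)) := by
  constructor
  · rintro ⟨h₁, h₂, h₃⟩
    refine ⟨?_, ?_, ?_⟩ <;> apply mul_left_cancel₀ (two_ne_zero (α := ℤ))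
    · linear_combination (-2 * a) * h₁ - c * h₂ + (2 * A * d - B * c) * hdet
    · linear_combination (-a) * h₂ - 2 * c * h₃ + (-2 * A * b + a * B) * hdet
    · linear_combination (-b) * h₂ - 2 * d * h₃ + (2 * C' * a - B * b) * hdet
  · rintro ⟨h₁, h₂, h₃⟩
    refine ⟨?_, ?_, ?_⟩
    · linear_combination (-d) * h₁ + c * h₂ + A * hdet
    · linear_combination (2 * b) * h₁ - 2 * a * h₂ + B * hdet
    · linear_combination b * h₂ - a * h₃ + C' * hdet

theorem exists_eq_mul_of_proportional {p q r A B D u v w : ℤ} (hpqr : u * p + v * q + w * r = 1)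
    (h₁ : A * q = B * p) (h₂ : A * r = D * p) (h₃ : B * r = D * q) :
    ∃ m, A = m * p ∧ B = m * q ∧ D = m * r :=
  ⟨u * A + v * B + w * D,
    by linear_combination (-A) * hpqr + v * h₁ + w * h₂,
    by linear_combination (-B) * hpqr - u * h₁ + w * h₃,
    by linear_combination (-D) * hpqr - u * h₂ - v * h₃⟩

theorem exists_bezout_gcd_gcd (x y z : ℤ) :
    ∃ u v w : ℤ, u * x + v * y + w * z = Int.gcd (Int.gcd x y : ℤ) z := by
  refine ⟨Int.gcdA x y * Int.gcdA (Int.gcd x y) z, Int.gcdB x y * Int.gcdA (Int.gcd x y) z,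
    Int.gcdB (Int.gcd x y) z, ?_⟩
  have h := Int.gcd_eq_gcd_ab (Int.gcd x y) z
  rw [h]
  linear_combination (-Int.gcdA (Int.gcd x y) z) * Int.gcd_eq_gcd_ab x y

/-- The form `Q_γ` has coefficients `(c, d - a, -b)` up to a nonzero factor, and is primitive. -/
theorem exists_Qform_coeffs (γ : SL2Z) (hγ : _root_.IsHyperbolic γ) :
    ∃ g p q r u v w : ℤ, g ≠ 0 ∧ γ.1 1 0 = g * p ∧ γ.1 1 1 - γ.1 0 0 = g * q ∧
      -γ.1 0 1 = g * r ∧ u * p + v * q + w * r = 1 ∧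
      Qform γ = C p * X 0 ^ 2 + C q * (X 0 * X 1) + C r * X 1 ^ 2 := by
  have hdet : γ.1 0 0 * γ.1 1 1 - γ.1 0 1 * γ.1 1 0 = 1 := by
    rw [← Matrix.det_fin_two, γ.2]
  unfold _root_.IsHyperbolic at hγ
  unfold Qform
  generalize γ.1 0 0 = a, γ.1 0 1 = b, γ.1 1 0 = c, γ.1 1 1 = d at *
  obtain ⟨u, v, w, hg⟩ := exists_bezout_gcd_gcd c (a - d) b
  have hgb : (Int.gcd (Int.gcd c (a - d) : ℤ) b : ℤ) ∣ b := Int.gcd_dvd_right _ _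
  have hgcd : (Int.gcd (Int.gcd c (a - d) : ℤ) b : ℤ) ∣ (Int.gcd c (a - d) : ℤ) :=
    Int.gcd_dvd_left _ _
  have hgc := hgcd.trans (Int.gcd_dvd_left c (a - d))
  have hgad := hgcd.trans (Int.gcd_dvd_right c (a - d))
  dsimp only
  generalize (Int.gcd (Int.gcd c (a - d) : ℤ) b : ℤ) = g at *
  have hg0 : g ≠ 0 := by
    rintro rfl
    rw [zero_dvd_iff] at hgb hgad
    obtain rfl := sub_eq_zero.1 hgad
    subst hgb
    rcases Int.eq_one_or_neg_one_of_mul_eq_one (by linarith : a * a = 1) with rfl | rfl <;>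
      norm_num at hγ
  obtain ⟨b', hb'⟩ := hgb
  obtain ⟨c', hc'⟩ := hgc
  obtain ⟨e', he'⟩ := hgad
  have hs : (a + d).sign * (a + d).sign = 1 := by
    have h0 : a + d ≠ 0 := by
      intro h
      norm_num [h] at hγ
    rcases lt_or_gt_of_ne h0 with h | h
    · simp [Int.sign_eq_neg_one_of_neg h]
    · simp [Int.sign_eq_one_of_pos h]
  generalize (a + d).sign = s at *
  rw [he', hb', hc', Int.mul_ediv_cancel_left _ hg0, Int.mul_ediv_cancel_left _ hg0,
    Int.mul_ediv_cancel_left _ hg0]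
  refine ⟨-s * g, -s * c', s * e', s * b', -s * u, s * v, s * w, ?_, ?_, ?_, ?_, ?_, ?_⟩
  · refine mul_ne_zero (neg_ne_zero.2 ?_) hg0
    rintro rfl
    simp at hs
  · linear_combination (-(g * c')) * hs
  · linear_combination (g * e') * hs - he'
  · linear_combination (g * b') * hs
  · apply mul_left_cancel₀ hg0
    linear_combination hg - u * hc' - v * he' - w * hb' + g * (u * c' + v * e' + w * b') * hs
  · simp only [map_mul, map_neg]
    ring

theorem stmt1 (γ : SL2Z) (hγ : IsHyperbolic γ) (A B C' : ℤ)
    (F : MvPolynomial (Fin 2) ℤ)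
    (hF : F = C A * X 0 ^ 2 + C B * (X 0 * X 1) + C C' * X 1 ^ 2) :
    (matAct γ.1 F = F ↔ ∃ m : ℤ, F = m • Qform γ) ∧
      (matAct γ.1 F = F → Int.gcd (Int.gcd A B : ℤ) C' = 1 →
        F = Qform γ ∨ F = -Qform γ) := by
  have hdet : γ.1 0 0 * γ.1 1 1 - γ.1 0 1 * γ.1 1 0 = 1 := by
    rw [← Matrix.det_fin_two, γ.2]
  obtain ⟨g, p, q, r, u, v, w, hg, hc, he, hb, hpqr, hQ⟩ := exists_Qform_coeffs γ hγ
  have hinv : matAct γ.1 F = F ↔ ∃ m, A = m * p ∧ B = m * q ∧ C' = m * r := by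
    rw [hF, matAct_quadratic]
    trans A * (γ.1 0 0 - γ.1 1 1) = -(B * γ.1 1 0) ∧ A * γ.1 0 1 = -(C' * γ.1 1 0) ∧
      B * γ.1 0 1 = C' * (γ.1 0 0 - γ.1 1 1)
    · rw [← invariant_iff_proportional hdet]
      exact ⟨coeffs_eq_of_quadratic_eq, fun ⟨h₁, h₂, h₃⟩ => by rw [h₁, h₂, h₃]⟩
    · constructor
      · rintro ⟨h₁, h₂, h₃⟩
        apply exists_eq_mul_of_proportional hpqr <;> apply mul_left_cancel₀ hg
        · linear_combination -h₁ + B * hc - A * he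
        · linear_combination -h₂ + C' * hc - A * hb
        · linear_combination -h₃ - B * hb + C' * he
      · rintro ⟨m, rfl, rfl, rfl⟩
        refine ⟨?_, ?_, ?_⟩
        · linear_combination (-(m * p)) * he + m * q * hc
        · linear_combination (-(m * p)) * hb + m * r * hc
        · linear_combination (-(m * q)) * hb + m * r * he
  have hsmul (m : ℤ) : m • Qform γ =
      C (m * p) * X 0 ^ 2 + C (m * q) * (X 0 * X 1) + C (m * r) * X 1 ^ 2 := by
    rw [hQ, smul_eq_C_mul]
    simp only [map_mul]
    ring
  have hmul : matAct γ.1 F = F ↔ ∃ m : ℤ, F = m • Qform γ := by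
    rw [hinv]
    refine exists_congr fun m => ?_
    rw [hsmul, hF]
    exact ⟨fun ⟨h₁, h₂, h₃⟩ => by rw [h₁, h₂, h₃], coeffs_eq_of_quadratic_eq⟩
  refine ⟨hmul, fun h hprim => ?_⟩
  obtain ⟨m, hm⟩ := hmul.1 h
  obtain ⟨h₁, h₂, h₃⟩ := coeffs_eq_of_quadratic_eq (hF.symm.trans (hm.trans (hsmul m)))
  have hm1 : m ∣ 1 := by
    rw [← Nat.cast_one, ← hprim]
    exact Int.dvd_coe_gcd (Int.dvd_coe_gcd ⟨p, h₁⟩ ⟨q, h₂⟩) ⟨r, h₃⟩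
  rcases Int.isUnit_iff.1 (isUnit_of_dvd_one hm1) with rfl | rfl
  · left
    rw [hm, one_smul]
  · right
    rw [hm, neg_smul, one_smul]
end

section
/- Let γ ∈ SL₂(ℤ) be hyperbolic, let s ∈ SL₂(ℤ), and let m ≥ 1 be an integer. Then sγᵐs⁻¹ is hyperbolic, and Q_{sγᵐs⁻¹} = s·Q_γ or Q_{sγᵐs⁻¹} = −(s·Q_γ). -/
open Matrix MvPolynomial

/-- The gcd of `c`, `a - d` and `b` for a matrix `(a b; c d)`. -/
def fixGcd (M : Matrix (Fin 2) (Fin 2) ℤ) : ℕ :=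
  Int.gcd (Int.gcd (M 1 0) (M 0 0 - M 1 1) : ℤ) (M 0 1)

/-- The quadratic form `c X₁² - (a - d) X₁X₂ - b X₂²` of a matrix `(a b; c d)`. -/
noncomputable def fixForm (M : Matrix (Fin 2) (Fin 2) ℤ) : MvPolynomial (Fin 2) ℤ :=
  C (M 1 0) * X 0 ^ 2 - C (M 0 0 - M 1 1) * (X 0 * X 1) - C (M 0 1) * X 1 ^ 2

lemma dvd_fixGcd_iff (M : Matrix (Fin 2) (Fin 2) ℤ) (k : ℕ) :
    k ∣ fixGcd M ↔ (k : ℤ) ∣ M 1 0 ∧ (k : ℤ) ∣ M 0 0 - M 1 1 ∧ (k : ℤ) ∣ M 0 1 := by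
  rw [← Int.natCast_dvd_natCast, fixGcd, Int.dvd_coe_gcd_iff, Int.dvd_coe_gcd_iff, and_assoc]

lemma C_fixGcd_mul_Qform (γ : SL2Z) :
    C (fixGcd γ.1 : ℤ) * Qform γ = C (-(γ.1 0 0 + γ.1 1 1).sign) * fixForm γ.1 := by
  obtain ⟨h₁, h₂, h₃⟩ := (dvd_fixGcd_iff γ.1 _).1 dvd_rfl
  have e₁ := congrArg (C (σ := Fin 2)) (Int.mul_ediv_cancel' h₁)
  have e₂ := congrArg (C (σ := Fin 2)) (Int.mul_ediv_cancel' h₂)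
  have e₃ := congrArg (C (σ := Fin 2)) (Int.mul_ediv_cancel' h₃)
  rw [C_mul] at e₁ e₂ e₃
  rw [fixForm, ← e₁, ← e₂, ← e₃]
  simp only [Qform, ← fixGcd.eq_1]
  ring

lemma conj_coe (s γ : SL2Z) :
    (s * γ * s⁻¹).1 = s.1 * γ.1 * !![s.1 1 1, -s.1 0 1; -s.1 1 0, s.1 0 0] := by
  change s.1 * γ.1 * s.1.adjugate = _
  rw [adjugate_fin_two]

lemma det_eq_one (s : SL2Z) : s.1 0 0 * s.1 1 1 - s.1 0 1 * s.1 1 0 = 1 := by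
  rw [← det_fin_two, s.2]

lemma fixGcd_dvd_conj (s γ : SL2Z) : fixGcd γ.1 ∣ fixGcd (s * γ * s⁻¹).1 := by
  obtain ⟨⟨x, hx⟩, ⟨y, hy⟩, ⟨z, hz⟩⟩ := (dvd_fixGcd_iff γ.1 _).1 dvd_rfl
  rw [dvd_fixGcd_iff, conj_coe]
  simp only [mul_apply, Fin.sum_univ_two, of_apply, cons_val', cons_val_zero, cons_val_one,
    cons_val_fin_one]
  rw [hx, hz, sub_eq_iff_eq_add.1 hy]
  refine ⟨⟨s.1 1 0 * s.1 1 1 * y + s.1 1 1 ^ 2 * x - s.1 1 0 ^ 2 * z, by ring⟩,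
    ⟨(s.1 0 0 * s.1 1 1 + s.1 0 1 * s.1 1 0) * y + 2 * s.1 0 1 * s.1 1 1 * x
      - 2 * s.1 0 0 * s.1 1 0 * z, by ring⟩,
    ⟨s.1 0 0 ^ 2 * z - s.1 0 1 ^ 2 * x - s.1 0 0 * s.1 0 1 * y, by ring⟩⟩

lemma fixGcd_conj (s γ : SL2Z) : fixGcd (s * γ * s⁻¹).1 = fixGcd γ.1 := by
  refine Nat.dvd_antisymm ?_ (fixGcd_dvd_conj s γ)
  simpa [mul_assoc] using fixGcd_dvd_conj s⁻¹ (s * γ * s⁻¹)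

lemma fixForm_conj (s γ : SL2Z) : fixForm (s * γ * s⁻¹).1 = matAct s.1 (fixForm γ.1) := by
  rw [conj_coe]
  simp only [fixForm, matAct, mul_apply, Fin.sum_univ_two, of_apply, cons_val', cons_val_zero,
    cons_val_one, cons_val_fin_one, map_sub, map_mul, map_pow, map_add, map_neg, bind₁_X_right,
    algHom_C, algebraMap_eq]
  ring

lemma trace_conj (s γ : SL2Z) :
    (s * γ * s⁻¹).1 0 0 + (s * γ * s⁻¹).1 1 1 = γ.1 0 0 + γ.1 1 1 := by
  rw [conj_coe]
  simp only [mul_apply, Fin.sum_univ_two, of_apply, cons_val', cons_val_zero, cons_val_one,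
    cons_val_fin_one]
  linear_combination (γ.1 0 0 + γ.1 1 1) * det_eq_one s

lemma fixGcd_smul_add (M : Matrix (Fin 2) (Fin 2) ℤ) (u v : ℤ) :
    fixGcd (u • M + v • 1) = u.natAbs * fixGcd M := by
  simp [fixGcd, -zsmul_eq_mul, -zsmul_one, ← mul_sub, Int.gcd_mul_left]
  simp [Int.gcd_def, Int.natAbs_abs, Int.natAbs_mul, Nat.gcd_mul_left]

lemma fixForm_smul_add (M : Matrix (Fin 2) (Fin 2) ℤ) (u v : ℤ) :
    fixForm (u • M + v • 1) = C u * fixForm M := by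
  simp [fixForm, -zsmul_eq_mul, -zsmul_one]
  ring

lemma isHyperbolic_iff (γ : SL2Z) :
    IsHyperbolic γ ↔ 0 < (γ.1 0 0 - γ.1 1 1) ^ 2 + 4 * γ.1 0 1 * γ.1 1 0 := by
  have h : (γ.1 0 0 - γ.1 1 1) ^ 2 + 4 * γ.1 0 1 * γ.1 1 0 = (γ.1 0 0 + γ.1 1 1) ^ 2 - 2 ^ 2 := by
    linear_combination -4 * det_eq_one γ
  rw [h, sub_pos, sq_lt_sq, _root_.IsHyperbolic, abs_two]

lemma IsHyperbolic.exists_pow_eq {γ : SL2Z} (hγ : IsHyperbolic γ) {m : ℕ} (hm : 1 ≤ m) :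
    ∃ u v : ℤ, u ≠ 0 ∧ (γ ^ m).1 = u • γ.1 + v • 1 := by
  suffices ∃ u v : ℤ, |v| < |u| ∧ (γ ^ m).1 = u • γ.1 + v • 1 by
    obtain ⟨u, v, huv, h⟩ := this
    exact ⟨u, v, abs_pos.1 ((abs_nonneg v).trans_lt huv), h⟩
  induction m, hm using Nat.le_induction with
  | base => exact ⟨1, 0, by simp, by simp⟩
  | succ m _ ih =>
    obtain ⟨u, v, huv, h⟩ := ih
    refine ⟨u * (γ.1 0 0 + γ.1 1 1) + v, -u, ?_, ?_⟩
    · rw [abs_neg]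
      have h₁ := abs_sub_abs_le_abs_sub (u * (γ.1 0 0 + γ.1 1 1)) (-v)
      rw [abs_mul, abs_neg, sub_neg_eq_add] at h₁
      unfold _root_.IsHyperbolic at hγ
      nlinarith [abs_nonneg u]
    · have hd := det_eq_one γ
      rw [pow_succ]
      change (γ ^ m).1 * γ.1 = _
      rw [h]
      ext i j
      fin_cases i <;> fin_cases j <;>
        simp [mul_apply, Fin.sum_univ_two, add_mul, -zsmul_eq_mul, -zsmul_one]
      · linear_combination -u * hd
      · ring
      · ring
      · linear_combination -u * hd

lemma IsHyperbolic.pow {γ : SL2Z} (hγ : IsHyperbolic γ) {m : ℕ} (hm : 1 ≤ m) :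
    IsHyperbolic (γ ^ m) := by
  obtain ⟨u, v, hu, h⟩ := hγ.exists_pow_eq hm
  rw [isHyperbolic_iff] at hγ ⊢
  rw [h]
  simp only [Matrix.add_apply, Matrix.smul_apply, smul_eq_mul, one_apply_eq, ne_eq, zero_ne_one, one_ne_zero,
    not_false_eq_true, one_apply_ne]
  have := mul_pos (sq_pos_of_ne_zero hu) hγ
  linarith

lemma IsHyperbolic.conj {γ : SL2Z} (hγ : IsHyperbolic γ) (s : SL2Z) :
    IsHyperbolic (s * γ * s⁻¹) := by
  rwa [_root_.IsHyperbolic, trace_conj]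

lemma IsHyperbolic.fixGcd_ne_zero {γ : SL2Z} (hγ : IsHyperbolic γ) : fixGcd γ.1 ≠ 0 := by
  intro h
  obtain ⟨h₁, h₂, -⟩ := (dvd_fixGcd_iff γ.1 0).1 (by rw [h])
  simp only [Nat.cast_zero, zero_dvd_iff] at h₁ h₂
  rw [isHyperbolic_iff, h₁, h₂] at hγ
  simp at hγ

lemma IsHyperbolic.sign_trace {γ : SL2Z} (hγ : IsHyperbolic γ) :
    (γ.1 0 0 + γ.1 1 1).sign = 1 ∨ (γ.1 0 0 + γ.1 1 1).sign = -1 := by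
  have h : γ.1 0 0 + γ.1 1 1 ≠ 0 := abs_pos.1 (two_pos.trans hγ)
  rcases h.lt_or_gt with h | h
  · exact Or.inr (Int.sign_eq_neg_one_of_neg h)
  · exact Or.inl (Int.sign_eq_one_of_pos h)

theorem stmt2 (γ s : SL2Z) (hγ : IsHyperbolic γ) (m : ℕ) (hm : 1 ≤ m) :
    IsHyperbolic (s * γ ^ m * s⁻¹) ∧
      (Qform (s * γ ^ m * s⁻¹) = matAct s.1 (Qform γ) ∨
        Qform (s * γ ^ m * s⁻¹) = -matAct s.1 (Qform γ)) := by
  have hN : IsHyperbolic (s * γ ^ m * s⁻¹) := (hγ.pow hm).conj s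
  refine ⟨hN, ?_⟩
  obtain ⟨u, v, -, h⟩ := hγ.exists_pow_eq hm
  have hg : C (σ := Fin 2) (fixGcd (s * γ ^ m * s⁻¹).1 : ℤ) ≠ 0 := by
    simpa using hN.fixGcd_ne_zero
  have hQN := C_fixGcd_mul_Qform (s * γ ^ m * s⁻¹)
  have hQγ := congrArg (matAct s.1) (C_fixGcd_mul_Qform γ)
  rw [fixForm_conj, h, fixForm_smul_add] at hQN
  rw [fixGcd_conj, h, fixGcd_smul_add] at hQN hg
  simp only [map_mul, matAct, algHom_C, algebraMap_eq, Nat.cast_mul] at hQN hQγ hg ⊢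
  rcases hN.sign_trace with h₁ | h₁ <;> rcases hγ.sign_trace with h₂ | h₂ <;>
    rcases Int.natAbs_eq u with h₃ | h₃ <;>
    rw [h₁, h₃] at hQN <;> rw [h₂] at hQγ <;>
    simp only [Int.natAbs_neg, Int.natAbs_natCast, neg_neg, map_neg, map_one] at hQN hQγ
  all_goals first
    | exact Or.inl (mul_left_cancel₀ hg (by linear_combination hQN - C (u.natAbs : ℤ) * hQγ))
    | exact Or.inl (mul_left_cancel₀ hg (by linear_combination hQN + C (u.natAbs : ℤ) * hQγ))
    | exact Or.inr (mul_left_cancel₀ hg (by linear_combination hQN - C (u.natAbs : ℤ) * hQγ))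
    | exact Or.inr (mul_left_cancel₀ hg (by linear_combination hQN + C (u.natAbs : ℤ) * hQγ))
end

section
/- Let γ ∈ SL₂(ℤ) be hyperbolic and let α ∈ M₂⁺(ℤ) be such that the rational matrix αγα⁻¹ has integer entries (hence αγα⁻¹ ∈ SL₂(ℤ) and is hyperbolic, having the same trace as γ). Then α·Q_γ is an integer multiple of Q_{αγα⁻¹}. -/
open Matrix MvPolynomial

/-- The form `det (v, M v)` of the vector of variables `v = (X₁, X₂)`. -/
noncomputable def wedgeForm (M : Matrix (Fin 2) (Fin 2) ℤ) : MvPolynomial (Fin 2) ℤ :=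
  C (M 1 0) * X 0 ^ 2 - C (M 0 0 - M 1 1) * (X 0 * X 1) - C (M 0 1) * X 1 ^ 2

/-- The greatest common divisor of the coefficients of `wedgeForm M`. -/
def wedgeContent (M : Matrix (Fin 2) (Fin 2) ℤ) : ℤ :=
  (Int.gcd (Int.gcd (M 1 0) (M 0 0 - M 1 1) : ℤ) (M 0 1) : ℤ)

lemma dvd_wedgeContent_iff {M : Matrix (Fin 2) (Fin 2) ℤ} {k : ℤ} :
    k ∣ wedgeContent M ↔ (k ∣ M 1 0 ∧ k ∣ M 0 0 - M 1 1) ∧ k ∣ M 0 1 := by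
  simp only [wedgeContent, Int.dvd_coe_gcd_iff]

lemma wedgeContent_ne_zero {γ : SL2Z} (hγ : IsHyperbolic γ) : wedgeContent γ.1 ≠ 0 := by
  intro h
  have h0 : (0 : ℤ) ∣ wedgeContent γ.1 := h ▸ dvd_rfl
  obtain ⟨⟨hc, had⟩, hb⟩ := dvd_wedgeContent_iff.1 h0
  rw [zero_dvd_iff] at hc had hb
  have hdet := γ.2
  rw [Matrix.det_fin_two, hc, hb] at hdet
  have hsq : γ.1 0 0 * γ.1 0 0 = 1 := by linear_combination hdet + γ.1 0 0 * had
  have had' : γ.1 1 1 = γ.1 0 0 := by linarith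
  unfold _root_.IsHyperbolic at hγ
  rw [had'] at hγ
  rcases mul_self_eq_one_iff.1 hsq with h | h <;> norm_num [h] at hγ

lemma C_wedgeContent_mul_Qform (γ : SL2Z) :
    C (wedgeContent γ.1) * Qform γ = C (-(γ.1 0 0 + γ.1 1 1).sign) * wedgeForm γ.1 := by
  obtain ⟨⟨hc, had⟩, hb⟩ := dvd_wedgeContent_iff.1 (dvd_refl (wedgeContent γ.1))
  have hc' := congrArg (C (σ := Fin 2)) (Int.mul_ediv_cancel' hc)
  have had' := congrArg (C (σ := Fin 2)) (Int.mul_ediv_cancel' had)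
  have hb' := congrArg (C (σ := Fin 2)) (Int.mul_ediv_cancel' hb)
  rw [C_mul] at hc' had' hb'
  change C (wedgeContent γ.1) * (C (-(γ.1 0 0 + γ.1 1 1).sign) *
    (C (γ.1 1 0 / wedgeContent γ.1) * X 0 ^ 2
      - C ((γ.1 0 0 - γ.1 1 1) / wedgeContent γ.1) * (X 0 * X 1)
      - C (γ.1 0 1 / wedgeContent γ.1) * X 1 ^ 2)) = _
  rw [wedgeForm]
  linear_combination C (-(γ.1 0 0 + γ.1 1 1).sign) *
    (X 0 ^ 2 * hc' - X 0 * X 1 * had' - X 1 ^ 2 * hb')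

lemma C_wedgeContent_dvd_wedgeForm (M : Matrix (Fin 2) (Fin 2) ℤ) :
    C (wedgeContent M) ∣ wedgeForm M := by
  obtain ⟨⟨hc, had⟩, hb⟩ := dvd_wedgeContent_iff.1 (dvd_refl (wedgeContent M))
  exact dvd_sub (dvd_sub ((map_dvd C hc).mul_right _) ((map_dvd C had).mul_right _))
    ((map_dvd C hb).mul_right _)

lemma dvd_mul_gcd {k n a b : ℤ} (ha : k ∣ n * a) (hb : k ∣ n * b) :
    k ∣ n * (Int.gcd a b : ℤ) := by
  rw [Int.gcd_eq_gcd_ab, mul_add, ← mul_assoc, ← mul_assoc]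
  exact dvd_add (ha.mul_right _) (hb.mul_right _)

lemma dvd_mul_wedgeContent {M : Matrix (Fin 2) (Fin 2) ℤ} {k n : ℤ}
    (h : C k ∣ C n * wedgeForm M) : k ∣ n * wedgeContent M := by
  have heval (v : Fin 2 → ℤ) : k ∣ n *
      (M 1 0 * v 0 ^ 2 - (M 0 0 - M 1 1) * (v 0 * v 1) - M 0 1 * v 1 ^ 2) := by
    simpa [wedgeForm] using map_dvd (eval v) h
  have hc : k ∣ n * M 1 0 := by simpa using heval ![1, 0]
  have hb : k ∣ n * M 0 1 := by simpa using heval ![0, 1]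
  have had : k ∣ n * (M 0 0 - M 1 1) := by
    have hsum : k ∣ n * (M 1 0 - (M 0 0 - M 1 1) - M 0 1) := by simpa using heval ![1, 1]
    have heq : n * (M 0 0 - M 1 1) =
        n * M 1 0 - n * M 0 1 - n * (M 1 0 - (M 0 0 - M 1 1) - M 0 1) := by ring
    exact heq ▸ dvd_sub (dvd_sub hc hb) hsum
  exact dvd_mul_gcd (dvd_mul_gcd hc had) hb

lemma mul_adjugate_eq_adjugate_mul {α M N : Matrix (Fin 2) (Fin 2) ℤ} (hα : α.det ≠ 0)
    (h : α * M = N * α) : M * α.adjugate = α.adjugate * N := by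
  have key : α.det • (M * α.adjugate) = α.det • (α.adjugate * N) := by
    calc α.det • (M * α.adjugate) = (α.adjugate * α) * (M * α.adjugate) := by
          rw [Matrix.adjugate_mul, Matrix.smul_mul, Matrix.one_mul]
      _ = α.adjugate * (α * M) * α.adjugate := by simp only [Matrix.mul_assoc]
      _ = (α.adjugate * N) * (α * α.adjugate) := by rw [h]; simp only [Matrix.mul_assoc]
      _ = α.det • (α.adjugate * N) := by
          rw [Matrix.mul_adjugate, Matrix.mul_smul, Matrix.mul_one]
  exact smul_right_injective _ hα key

lemma trace_eq_of_mul_eq_mul {α M N : Matrix (Fin 2) (Fin 2) ℤ} (hα : α.det ≠ 0)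
    (h : α * M = N * α) : N.trace = M.trace := by
  refine mul_left_cancel₀ hα ?_
  calc α.det * N.trace = (N * (α * α.adjugate)).trace := by
        rw [Matrix.mul_adjugate, Matrix.mul_smul, Matrix.mul_one, Matrix.trace_smul, smul_eq_mul]
    _ = (α * (M * α.adjugate)).trace := by rw [← Matrix.mul_assoc, ← h, Matrix.mul_assoc]
    _ = (M * (α.adjugate * α)).trace := by rw [Matrix.trace_mul_comm, Matrix.mul_assoc]
    _ = α.det * M.trace := by
        rw [Matrix.adjugate_mul, Matrix.mul_smul, Matrix.mul_one, Matrix.trace_smul, smul_eq_mul]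

lemma matAct_wedgeForm {α M N : Matrix (Fin 2) (Fin 2) ℤ} (hα : α.det ≠ 0)
    (h : α * M = N * α) : matAct α (wedgeForm M) = C α.det * wedgeForm N := by
  have hadj := mul_adjugate_eq_adjugate_mul hα h
  have hC (i j : Fin 2) := congrArg (fun A => C (σ := Fin 2) (A i j)) hadj
  have h00 := hC 0 0
  have h01 := hC 0 1
  have h10 := hC 1 0
  have h11 := hC 1 1
  simp only [Matrix.adjugate_fin_two, Matrix.mul_apply, Fin.sum_univ_two, Matrix.of_apply,
    Matrix.cons_val', Matrix.cons_val_zero, Matrix.cons_val_one, Matrix.cons_val_fin_one,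
    C_add, C_mul, C_neg] at h00 h01 h10 h11
  simp only [wedgeForm, matAct, Matrix.det_fin_two, map_sub, map_mul, map_pow, bind₁_X_right,
    bind₁_C_right, Matrix.cons_val_zero, Matrix.cons_val_one]
  linear_combination
    (C (α 1 1) * X 0 - C (α 0 1) * X 1) * (X 0 * h10 + X 1 * h11)
      - (-C (α 1 0) * X 0 + C (α 0 0) * X 1) * (X 0 * h00 + X 1 * h01)

theorem stmt3 (γ : SL2Z) (hγ : IsHyperbolic γ)
    (α : Matrix (Fin 2) (Fin 2) ℤ) (hα : 0 < α.det)
    (δ : SL2Z) (hδ : α * γ.1 = δ.1 * α) :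
    IsHyperbolic δ ∧ δ.1 0 0 + δ.1 1 1 = γ.1 0 0 + γ.1 1 1 ∧
      ∃ m : ℤ, matAct α (Qform γ) = m • Qform δ := by
  have htr : δ.1 0 0 + δ.1 1 1 = γ.1 0 0 + γ.1 1 1 := by
    simpa only [Matrix.trace_fin_two] using trace_eq_of_mul_eq_mul hα.ne' hδ
  refine ⟨by rwa [_root_.IsHyperbolic, htr], htr, ?_⟩
  have hact := matAct_wedgeForm hα.ne' hδ
  have hmap (n : ℤ) : matAct α (C n) = C n := (matAct α).commutes n
  have hdvd : C (wedgeContent γ.1) ∣ C α.det * wedgeForm δ.1 := by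
    rw [← hact, ← hmap]
    exact map_dvd (matAct α) (C_wedgeContent_dvd_wedgeForm γ.1)
  obtain ⟨m, hm⟩ := dvd_mul_wedgeContent hdvd
  refine ⟨m, mul_left_cancel₀ (C_ne_zero.2 (wedgeContent_ne_zero hγ)) ?_⟩
  have hQγ := congrArg (matAct α) (C_wedgeContent_mul_Qform γ)
  rw [map_mul, map_mul, hmap, hmap, hact] at hQγ
  have hQδ := C_wedgeContent_mul_Qform δ
  rw [htr] at hQδ
  have hm' := congrArg (C (σ := Fin 2)) hm
  rw [C_mul, C_mul] at hm'
  rw [smul_eq_C_mul]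
  linear_combination hQγ - C α.det * hQδ + Qform δ * hm'
end

section
/- Let N ≥ 1 and let Γ be a subgroup with Γ₁(N) ⊆ Γ ⊆ Γ₀(N). Then the abelianization of Γ̄ (the image of Γ in PSL₂(ℤ)) is generated by the images of the hyperbolic elements of Γ. Equivalently, for trivial coefficients (k = 0), the subgroup 𝔷_{Γ,0} generated by the classes of hyperbolic elements equals all of H₁(Γ̄, ℤ) = Γ̄^{ab}. -/
open Matrix MvPolynomial

/-- The subgroup `{±1}` of `SL₂(ℤ)`. -/
def negSub : Subgroup SL2Z := Subgroup.zpowers (-1 : SL2Z)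

instance : negSub.Normal := by
  constructor
  intro x hx g
  obtain ⟨n, hn⟩ := Subgroup.mem_zpowers_iff.mp hx
  have hc : Commute g x := hn ▸ (Commute.neg_one_right g).zpow_right n
  have : g * x * g⁻¹ = x := by
    rw [hc.eq, mul_assoc, mul_inv_cancel, mul_one]
  rwa [this]

/-- `PSL₂(ℤ) := SL₂(ℤ)/{±1}`. -/
abbrev PSL2Z := SL2Z ⧸ negSub

/-- The projection `SL₂(ℤ) → PSL₂(ℤ)`. -/
def projHom : SL2Z →* PSL2Z := QuotientGroup.mk' negSub

/-- The image `Γ̄` of a subgroup `Γ ≤ SL₂(ℤ)` in `PSL₂(ℤ)`. -/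
def Gammabar (Γ : Subgroup SL2Z) : Subgroup PSL2Z := Γ.map projHom

open CongruenceSubgroup in
/-- Every matrix can be multiplied by a hyperbolic element of `Γ₁(N)` so that the product is
hyperbolic. -/
lemma exists_mem_Gamma1_isHyperbolic_mul (N : ℕ) (hN : 1 ≤ N) (γ : SL2Z) :
    ∃ h ∈ Gamma1 N, IsHyperbolic h ∧ IsHyperbolic (γ * h) := by
  have hdet := γ.det_coe
  rw [Matrix.det_fin_two] at hdet
  have hN' : (1 : ℤ) ≤ N := by exact_mod_cast hN
  obtain ⟨m, hm, hB⟩ : ∃ m : ℤ, 1 ≤ m ∧ γ.1 0 0 * N * m + γ.1 0 1 ≠ 0 := by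
    by_contra! H
    have h₁ := H 1 le_rfl
    have h₂ := H 2 (by norm_num)
    have ha : γ.1 0 0 * N = 0 := by linarith
    have hb : γ.1 0 1 = 0 := by linarith
    have ha' : γ.1 0 0 = 0 := (mul_eq_zero.mp ha).resolve_right (by omega)
    simp [ha', hb] at hdet
  set B := γ.1 0 0 * N * m + γ.1 0 1
  set A := γ.1 0 0 + γ.1 1 1 + γ.1 1 0 * N * m
  set t : ℤ := |A| + 3
  have ht0 : 3 ≤ t := by have := abs_nonneg A; omega
  let h : SL2Z := ⟨!![1 + N * N * m * t, N * m; N * t, 1], by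
    rw [Matrix.det_fin_two_of]; ring⟩
  refine ⟨h, ?_, ?_, ?_⟩
  · rw [Gamma1_mem]
    simp [h]
  · have : (1 : ℤ) ≤ N * N * m := by
      have : 0 < (N : ℤ) * N * m := by positivity
      omega
    change 2 < |1 + (N : ℤ) * N * m * t + 1|
    exact lt_abs.mpr (Or.inl (by nlinarith))
  · have htr : (γ * h).1 0 0 + (γ * h).1 1 1 = A + N * B * t := by
      change (γ.1 * h.1) 0 0 + (γ.1 * h.1) 1 1 = _
      simp only [h, Matrix.mul_apply, Fin.sum_univ_two, A, B, of_apply, cons_val]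
      ring
    have hNB : 1 ≤ |(N : ℤ) * B| := Int.one_le_abs (mul_ne_zero (by omega) hB)
    have hle : t ≤ |(N : ℤ) * B * t| := by
      rw [abs_mul, abs_of_nonneg (by omega : 0 ≤ t)]
      nlinarith
    rw [_root_.IsHyperbolic, htr]
    have := abs_sub_abs_le_abs_sub ((N : ℤ) * B * t) (-A)
    rw [abs_neg, sub_neg_eq_add, add_comm _ A] at this
    omega

open CongruenceSubgroup in
theorem stmt5 (N : ℕ) (hN : 1 ≤ N) (Γ : Subgroup SL2Z)
    (h1 : Gamma1 N ≤ Γ) (h2 : Γ ≤ Gamma0 N) :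
    Subgroup.closure {x : Abelianization ↥(Gammabar Γ) |
      ∃ (γ : SL2Z) (hγ : γ ∈ Γ), IsHyperbolic γ ∧
        x = Abelianization.of ⟨projHom γ, Subgroup.mem_map_of_mem projHom hγ⟩} = ⊤ := by
  rw [eq_top_iff]
  rintro x -
  obtain ⟨⟨_, γ, hγ, rfl⟩, rfl⟩ := QuotientGroup.mk_surjective x
  obtain ⟨h, hh, hyp, hyp_mul⟩ := exists_mem_Gamma1_isHyperbolic_mul N hN γ
  have hmem := h1 hh
  have hmul : (⟨projHom γ, Subgroup.mem_map_of_mem projHom hγ⟩ : ↥(Gammabar Γ)) =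
      ⟨projHom (γ * h), Subgroup.mem_map_of_mem projHom (Γ.mul_mem hγ hmem)⟩ *
        ⟨projHom h, Subgroup.mem_map_of_mem projHom hmem⟩⁻¹ :=
    Subtype.ext (by simp)
  change Abelianization.of (⟨projHom γ, _⟩ : ↥(Gammabar Γ)) ∈ _
  rw [hmul, map_mul, map_inv]
  exact Subgroup.mul_mem _
    (Subgroup.subset_closure ⟨γ * h, Γ.mul_mem hγ hmem, hyp_mul, rfl⟩)
    (Subgroup.inv_mem _ (Subgroup.subset_closure ⟨h, hmem, hyp, rfl⟩))
end

section
/- Let N ≥ 1 be a squarefree integer and let γ ∈ Γ₀(N) be parabolic (|trace(γ)| = 2, γ ≠ ±I). If trace(γ) = 2 then γ ∈ Γ₁(N), and if trace(γ) = −2 then −γ ∈ Γ₁(N). In particular, every parabolic element of the image of Γ₀(N) in PSL₂(ℤ) lies in the image of Γ₁(N). -/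
open Matrix CongruenceSubgroup

theorem mem_Gamma1_of_mem_Gamma0_of_trace_eq_two {N : ℕ} (hN : Squarefree N) {γ : SL2Z}
    (hγ : γ ∈ Gamma0 N) (htr : γ.1 0 0 + γ.1 1 1 = 2) : γ ∈ Gamma1 N := by
  have hc : (N : ℤ) ∣ γ.1 1 0 := (ZMod.intCast_zmod_eq_zero_iff_dvd _ N).mp hγ
  have hdet := γ.2
  rw [Matrix.det_fin_two] at hdet
  have hsq : (γ.1 0 0 - 1) ^ 2 = -γ.1 0 1 * γ.1 1 0 := by
    linear_combination γ.1 0 0 * htr - hdet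
  have ha : (N : ℤ) ∣ γ.1 0 0 - 1 := by
    rw [← (Int.squarefree_natCast.mpr hN).dvd_pow_iff_dvd two_ne_zero, hsq]
    exact hc.mul_left _
  have ha' : ((γ.1 0 0 : ℤ) : ZMod N) = 1 := by
    have h := (ZMod.intCast_zmod_eq_zero_iff_dvd _ N).mpr ha
    push_cast at h
    exact sub_eq_zero.mp h
  have htr' : ((γ.1 0 0 : ℤ) : ZMod N) + ((γ.1 1 1 : ℤ) : ZMod N) = 2 := by
    exact_mod_cast congrArg (Int.cast : ℤ → ZMod N) htr
  exact (Gamma1_mem N γ).mpr ⟨ha', by linear_combination htr' - ha', hγ⟩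

theorem stmt8 (N : ℕ) (hN : 1 ≤ N) (hsq : Squarefree N) (γ : SL2Z)
    (hγ0 : γ ∈ Gamma0 N)
    (htr : |γ.1 0 0 + γ.1 1 1| = 2) (h1 : γ ≠ 1) (h2 : γ ≠ -1) :
    (γ.1 0 0 + γ.1 1 1 = 2 → γ ∈ Gamma1 N) ∧
      (γ.1 0 0 + γ.1 1 1 = -2 → -γ ∈ Gamma1 N) := by
  refine ⟨mem_Gamma1_of_mem_Gamma0_of_trace_eq_two hsq hγ0, fun h =>
    mem_Gamma1_of_mem_Gamma0_of_trace_eq_two hsq ?_ ?_⟩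
  · rw [Gamma0_mem] at hγ0 ⊢
    simpa using hγ0
  · change -γ.1 0 0 + -γ.1 1 1 = 2
    linarith
end

section
/- Let p be a prime, N ≥ 1 with p ∤ N, and let Γ be a subgroup with Γ₁(N) ⊆ Γ ⊆ Γ₀(N). Set Γ' := Γ ∩ Γ₀(p), and choose integers m, n with mp − nN = 1 and set β := (m n; N p) ∈ Γ₀(N). Then, as subsets of the 2×2 integer matrices, {g·(1 0; 0 p)·h : g ∈ Γ', h ∈ Γ} equals the union of the right cosets Γ'·(1 j; 0 p) for j = 0, 1, …, p−1 together with Γ'·β·(p 0; 0 1), and these p+1 right cosets are pairwise disjoint. -/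
open Matrix CongruenceSubgroup

/-- The right coset `Δ·α` of a subgroup `Δ ≤ SL₂(ℤ)` and an integer matrix `α`,
as a set of integer matrices. -/
def rightCosetSet (Δ : Subgroup SL2Z) (α : Matrix (Fin 2) (Fin 2) ℤ) :
    Set (Matrix (Fin 2) (Fin 2) ℤ) :=
  {x | ∃ g ∈ Δ, x = (g : SL2Z).1 * α}

theorem coe_mul_inv (x y : SL2Z) :
    (x * y⁻¹).1 = x.1 * !![y.1 1 1, -y.1 0 1; -y.1 1 0, y.1 0 0] :=
  (Matrix.SpecialLinearGroup.coe_mul x y⁻¹).trans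
    (congrArg (x.1 * ·) ((Matrix.SpecialLinearGroup.coe_inv y).trans (adjugate_fin_two _)))

theorem mem_Gamma0_iff_dvd {N : ℕ} {x : SL2Z} : x ∈ Gamma0 N ↔ (N : ℤ) ∣ x.1 1 0 := by
  rw [Gamma0_mem]
  exact ZMod.intCast_zmod_eq_zero_iff_dvd _ _

theorem mem_Gamma1_of_dvd {N : ℕ} {x : SL2Z} (ha : (N : ℤ) ∣ x.1 0 0 - 1)
    (hd : (N : ℤ) ∣ x.1 1 1 - 1) (hc : (N : ℤ) ∣ x.1 1 0) : x ∈ Gamma1 N := by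
  rw [← ZMod.intCast_zmod_eq_zero_iff_dvd] at ha hd hc
  rw [Gamma1_mem]
  push_cast at ha hd
  exact ⟨sub_eq_zero.mp ha, sub_eq_zero.mp hd, hc⟩

/-- For `Γ₁(N) ≤ Γ ≤ Γ₀(N)`, membership in `Γ` of an element of `Γ₀(N)` only depends on its
diagonal. -/
theorem mem_of_mem_of_diag_eq {N : ℕ} {Γ : Subgroup SL2Z} (h1 : Gamma1 N ≤ Γ)
    (h2 : Γ ≤ Gamma0 N) {x y : SL2Z} (hy : y ∈ Γ) (hx : (N : ℤ) ∣ x.1 1 0)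
    (ha : x.1 0 0 = y.1 0 0) (hd : x.1 1 1 = y.1 1 1) : x ∈ Γ := by
  have hc := mem_Gamma0_iff_dvd.mp (h2 hy)
  have hdet := y.2
  have hdet' := x.2
  rw [Matrix.det_fin_two] at hdet hdet'
  have key : x * y⁻¹ ∈ Γ := by
    apply h1
    obtain ⟨u, hu⟩ := hc
    obtain ⟨v, hv⟩ := hx
    apply mem_Gamma1_of_dvd <;> rw [coe_mul_inv] <;>
      simp only [mul_apply, Fin.sum_univ_two, of_apply, cons_val_zero,
          cons_val_one, cons_val', cons_val_fin_one]
    · refine ⟨y.1 0 1 * u - x.1 0 1 * u, ?_⟩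
      rw [ha]
      linear_combination hdet + (y.1 0 1 - x.1 0 1) * hu
    · refine ⟨y.1 0 1 * u - y.1 0 1 * v, ?_⟩
      rw [hd]
      linear_combination hdet + y.1 0 1 * hu - y.1 0 1 * hv
    · refine ⟨v * y.1 1 1 - x.1 1 1 * u, ?_⟩
      linear_combination y.1 1 1 * hv - x.1 1 1 * hu
  simpa using Γ.mul_mem key hy

/-- If `p` divides the upper right entry of `k ∈ Γ`, then conjugation by `diag(1, p)` moves `k`
into `Γ ∩ Γ₀(p)`. -/
theorem exists_diag_mul_eq {p N : ℕ} {Γ : Subgroup SL2Z} (h1 : Gamma1 N ≤ Γ)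
    (h2 : Γ ≤ Gamma0 N) {k : SL2Z} (hk : k ∈ Γ) (hb : (p : ℤ) ∣ k.1 0 1) :
    ∃ g ∈ Γ ⊓ Gamma0 p, !![1, 0; 0, (p : ℤ)] * k.1 = g.1 * !![1, 0; 0, (p : ℤ)] := by
  obtain ⟨b, hb⟩ := hb
  have hdet := k.2
  rw [Matrix.det_fin_two] at hdet
  have hc := mem_Gamma0_iff_dvd.mp (h2 hk)
  let g : SL2Z := ⟨!![k.1 0 0, b; p * k.1 1 0, k.1 1 1], by
    rw [det_fin_two_of]; linear_combination hdet + k.1 1 0 * hb⟩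
  refine ⟨g, ⟨?_, ?_⟩, ?_⟩
  · refine mem_of_mem_of_diag_eq h1 h2 hk ?_ ?_ ?_
    · simpa [g] using hc.mul_left (p : ℤ)
    · simp [g]
    · simp [g]
  · exact mem_Gamma0_iff_dvd.mpr (by simp [g])
  · ext i j
    fin_cases i <;> fin_cases j <;> simp [g, mul_apply, hb, mul_comm]

theorem diag_mul_mem_rightCosetSet {p N : ℕ} {Γ : Subgroup SL2Z} (h1 : Gamma1 N ≤ Γ)
    (h2 : Γ ≤ Gamma0 N) {g h r : SL2Z} (hg : g ∈ Γ ⊓ Gamma0 p) (hh : h ∈ Γ) (hr : r ∈ Γ)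
    (hb : (p : ℤ) ∣ (h * r⁻¹).1 0 1) :
    g.1 * !![1, 0; 0, (p : ℤ)] * h.1 ∈
      rightCosetSet (Γ ⊓ Gamma0 p) (!![1, 0; 0, (p : ℤ)] * r.1) := by
  obtain ⟨g', hg', e⟩ := exists_diag_mul_eq h1 h2 (Γ.mul_mem hh (Γ.inv_mem hr)) hb
  refine ⟨g * g', Subgroup.mul_mem _ hg hg', ?_⟩
  have hhr : h.1 = (h * r⁻¹).1 * r.1 := by
    refine Eq.trans ?_ (Matrix.SpecialLinearGroup.coe_mul (h * r⁻¹) r)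
    rw [inv_mul_cancel_right]
  have hgg : (g * g').1 = g.1 * g'.1 := Matrix.SpecialLinearGroup.coe_mul g g'
  rw [hgg, hhr, Matrix.mul_assoc g.1, ← Matrix.mul_assoc _ _ r.1, e]
  simp only [Matrix.mul_assoc]

theorem not_dvd_of_mem_Gamma0 {p : ℕ} (hp : p.Prime) {g : SL2Z} (hg : g ∈ Gamma0 p) :
    ¬ (p : ℤ) ∣ g.1 0 0 := by
  intro h
  have hc := mem_Gamma0_iff_dvd.mp hg
  have hdet := g.2
  rw [Matrix.det_fin_two] at hdet
  refine (Nat.prime_iff_prime_int.mp hp).not_dvd_one ?_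
  rw [← hdet]
  exact dvd_sub (h.mul_right _) (hc.mul_left _)

theorem exists_lt_dvd_sub_mul {p : ℕ} (hp : p.Prime) {a : ℤ} (ha : ¬ (p : ℤ) ∣ a) (b : ℤ) :
    ∃ j < p, (p : ℤ) ∣ b - a * j := by
  have : Fact p.Prime := ⟨hp⟩
  have ha' : (a : ZMod p) ≠ 0 := by rwa [Ne, ZMod.intCast_zmod_eq_zero_iff_dvd]
  refine ⟨((b : ZMod p) / a).val, ZMod.val_lt _, ?_⟩
  rw [← ZMod.intCast_zmod_eq_zero_iff_dvd]
  push_cast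
  rw [ZMod.natCast_zmod_val, mul_div_cancel₀ _ ha', sub_self]

theorem stmt14 (p N : ℕ) (hp : p.Prime) (hN : 1 ≤ N) (hpN : ¬ p ∣ N)
    (Γ : Subgroup SL2Z) (h1 : Gamma1 N ≤ Γ) (h2 : Γ ≤ Gamma0 N)
    (m n : ℤ) (hmn : m * p - n * N = 1) :
    {x : Matrix (Fin 2) (Fin 2) ℤ | ∃ g ∈ Γ ⊓ Gamma0 p, ∃ h ∈ Γ,
        x = (g : SL2Z).1 * !![1, 0; 0, (p : ℤ)] * (h : SL2Z).1}
      = (⋃ j ∈ Finset.range p,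
          rightCosetSet (Γ ⊓ Gamma0 p) !![1, (j : ℤ); 0, (p : ℤ)])
        ∪ rightCosetSet (Γ ⊓ Gamma0 p) (!![m, n; (N : ℤ), (p : ℤ)] * !![(p : ℤ), 0; 0, 1]) ∧
    (∀ i ∈ Finset.range p, ∀ j ∈ Finset.range p, i ≠ j →
      Disjoint (rightCosetSet (Γ ⊓ Gamma0 p) !![1, (i : ℤ); 0, (p : ℤ)])
        (rightCosetSet (Γ ⊓ Gamma0 p) !![1, (j : ℤ); 0, (p : ℤ)])) ∧
    (∀ j ∈ Finset.range p,
      Disjoint (rightCosetSet (Γ ⊓ Gamma0 p) !![1, (j : ℤ); 0, (p : ℤ)])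
        (rightCosetSet (Γ ⊓ Gamma0 p) (!![m, n; (N : ℤ), (p : ℤ)] * !![(p : ℤ), 0; 0, 1]))) := by
  let t : ℤ → SL2Z := fun j => ⟨!![1, j; 0, 1], by simp⟩
  let r : SL2Z := ⟨!![m * p, n; (N : ℤ), 1], by rw [det_fin_two_of]; linear_combination hmn⟩
  have ht : ∀ j, t j ∈ Γ := fun j => h1 (mem_Gamma1_of_dvd (by simp [t]) (by simp [t]) (by simp [t]))
  have hr : r ∈ Γ := h1 (mem_Gamma1_of_dvd
    ⟨n, by simp only [r, of_apply, cons_val_zero, cons_val']; linear_combination hmn⟩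
    (by simp [r]) (by simp [r]))
  have et : ∀ j : ℤ, !![1, j; 0, (p : ℤ)] = !![1, 0; 0, (p : ℤ)] * (t j).1 := by
    intro j; simp [t]
  have er : !![m, n; (N : ℤ), (p : ℤ)] * !![(p : ℤ), 0; 0, 1] =
      !![1, 0; 0, (p : ℤ)] * r.1 := by
    simp [r, mul_comm]
  refine ⟨?_, ?_, ?_⟩
  · ext x
    simp only [Set.mem_ofPred_eq, Set.mem_union, Set.mem_iUnion, Finset.mem_range, exists_prop]
    constructor
    · rintro ⟨g, hg, h, hh, rfl⟩
      by_cases ha : (p : ℤ) ∣ h.1 0 0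
      · right
        rw [er]
        refine diag_mul_mem_rightCosetSet h1 h2 hg hh hr ?_
        obtain ⟨a, ha⟩ := ha
        refine ⟨h.1 0 1 * m - a * n, ?_⟩
        rw [coe_mul_inv]
        simp only [mul_apply, Fin.sum_univ_two, of_apply, cons_val_zero,
          cons_val_one, cons_val', cons_val_fin_one, r]
        linear_combination -n * ha
      · left
        obtain ⟨j, hj, hd⟩ := exists_lt_dvd_sub_mul hp ha (h.1 0 1)
        refine ⟨j, hj, ?_⟩
        rw [et]
        refine diag_mul_mem_rightCosetSet h1 h2 hg hh (ht j) ?_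
        convert hd using 1
        rw [coe_mul_inv]
        simp only [mul_apply, Fin.sum_univ_two, of_apply, cons_val_zero,
          cons_val_one, cons_val', cons_val_fin_one, t]
        ring
    · rintro (⟨j, -, g, hg, rfl⟩ | ⟨g, hg, rfl⟩)
      · exact ⟨g, hg, t j, ht j, by rw [et, Matrix.mul_assoc]⟩
      · exact ⟨g, hg, r, hr, by rw [er, Matrix.mul_assoc]⟩
  · intro i hi j hj hij
    rw [Set.disjoint_left]
    rintro x ⟨g, hg, rfl⟩ ⟨g', hg', e⟩
    have e0 := congrFun (congrFun e 0) 0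
    have e1 := congrFun (congrFun e 0) 1
    simp [mul_apply] at e0 e1
    have hdvd : (p : ℤ) ∣ g.1 0 0 * ((i : ℤ) - j) :=
      ⟨g'.1 0 1 - g.1 0 1, by rw [← e0] at e1; linear_combination e1⟩
    have hij' := ((Nat.prime_iff_prime_int.mp hp).dvd_or_dvd hdvd).resolve_left
      (not_dvd_of_mem_Gamma0 hp hg.2)
    have hmod := (Nat.modEq_iff_dvd.mpr hij').symm
    exact hij (hmod.eq_of_lt_of_lt (Finset.mem_range.mp hi) (Finset.mem_range.mp hj))
  · intro j _
    rw [Set.disjoint_left]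
    rintro x ⟨g, hg, rfl⟩ ⟨g', hg', e⟩
    have e0 := congrFun (congrFun e 0) 0
    simp [mul_apply] at e0
    exact not_dvd_of_mem_Gamma0 hp hg.2
      ⟨g'.1 0 0 * m + g'.1 0 1 * N, by linear_combination e0⟩
end

section
/- Let p be a prime, N ≥ 1 with p ∤ N, and let Γ be a subgroup with Γ₁(N) ⊆ Γ ⊆ Γ₀(N). Set Γ' := Γ ∩ Γ₀(p), choose integers m, n with mp − nN = 1, set β := (m n; N p) and X := β·(p 0; 0 1) (a matrix of determinant p). Then conjugation by X preserves Γ': for every g ∈ Γ' the rational matrix X⁻¹gX has integer entries and lies in Γ', and the map g ↦ X⁻¹gX is a bijection of Γ' onto itself. Consequently Γ'·X·Γ' = Γ'·X as sets of integer matrices. -/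
open Matrix CongruenceSubgroup

theorem mem_of_Gamma1_le_of_diag_congr {N : ℕ} {Γ : Subgroup SL2Z} (h1 : Gamma1 N ≤ Γ)
    {A B : SL2Z} (hA : A ∈ Γ) (hA10 : (N : ℤ) ∣ A.1 1 0) (hB10 : (N : ℤ) ∣ B.1 1 0)
    (h00 : (N : ℤ) ∣ B.1 0 0 - A.1 0 0) (h11 : (N : ℤ) ∣ B.1 1 1 - A.1 1 1) : B ∈ Γ := by
  suffices h : B * A⁻¹ ∈ Gamma1 N by simpa using Γ.mul_mem (h1 h) hA
  have hdet : A.1 0 0 * A.1 1 1 - A.1 0 1 * A.1 1 0 = 1 := by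
    rw [← Matrix.det_fin_two]; exact A.2
  obtain ⟨u, hu⟩ := hA10
  obtain ⟨v, hv⟩ := hB10
  obtain ⟨s, hs⟩ := h00
  obtain ⟨t, ht⟩ := h11
  have key (x : ℤ) (y : ℤ) (h : (N : ℤ) ∣ x - y) : (x : ZMod N) = y :=
    ((ZMod.intCast_eq_intCast_iff_dvd_sub y x N).2 h).symm
  rw [Gamma1_mem]
  have e : (B * A⁻¹).1 = B.1 * !![A.1 1 1, -A.1 0 1; -A.1 1 0, A.1 0 0] := by
    rw [Matrix.SpecialLinearGroup.SL2_inv_expl]; rfl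
  change (((B * A⁻¹).1 0 0 : ℤ) : ZMod N) = 1 ∧ (((B * A⁻¹).1 1 1 : ℤ) : ZMod N) = 1 ∧
    (((B * A⁻¹).1 1 0 : ℤ) : ZMod N) = 0
  rw [e]
  simp only [Matrix.mul_apply, Fin.sum_univ_two, Matrix.of_apply, Matrix.cons_val',
    Matrix.cons_val_zero, Matrix.cons_val_one, Matrix.cons_val_fin_one]
  refine ⟨?_, ?_, ?_⟩
  · refine Eq.trans ?_ Int.cast_one
    exact key _ _ ⟨s * A.1 1 1 + (A.1 0 1 - B.1 0 1) * u, by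
      linear_combination A.1 1 1 * hs + hdet + (A.1 0 1 - B.1 0 1) * hu⟩
  · refine Eq.trans ?_ Int.cast_one
    exact key _ _ ⟨t * A.1 0 0 + A.1 0 1 * (u - v), by
      linear_combination A.1 0 0 * ht + hdet + A.1 0 1 * (hu - hv)⟩
  · refine Eq.trans ?_ Int.cast_zero
    exact key _ _ ⟨v * A.1 1 1 - B.1 1 1 * u, by
      linear_combination A.1 1 1 * hv - B.1 1 1 * hu⟩

theorem dvd_of_mem_Gamma0 {N : ℕ} {A : SL2Z} (h : A ∈ Gamma0 N) : (N : ℤ) ∣ A.1 1 0 :=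
  (ZMod.intCast_zmod_eq_zero_iff_dvd _ _).1 (Gamma0_mem.1 h)

theorem fin_two_congr {R : Type*} {a b c d a' b' c' d' : R} (ha : a = a') (hb : b = b')
    (hc : c = c') (hd : d = d') : !![a, b; c, d] = !![a', b'; c', d'] := by
  subst ha hb hc hd; rfl

theorem exists_mul_eq_mul_of_mem {p N : ℕ} (hp : p ≠ 0)
    {Γ : Subgroup SL2Z} (h1 : Gamma1 N ≤ Γ) (h2 : Γ ≤ Gamma0 N)
    {m n : ℤ} (hmn : m * p - n * N = 1) {g : SL2Z} (hg : g ∈ Γ ⊓ Gamma0 p) :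
    (∃ g' ∈ Γ ⊓ Gamma0 p, g.1 * !![m * p, n; (N : ℤ) * p, (p : ℤ)] =
      !![m * p, n; (N : ℤ) * p, (p : ℤ)] * g'.1) ∧
    (∃ g' ∈ Γ ⊓ Gamma0 p, g'.1 * !![m * p, n; (N : ℤ) * p, (p : ℤ)] =
      !![m * p, n; (N : ℤ) * p, (p : ℤ)] * g.1) := by
  have hN := dvd_of_mem_Gamma0 (h2 hg.1)
  obtain ⟨k, hk⟩ := dvd_of_mem_Gamma0 hg.2
  have hdX : (!![m * p, n; (N : ℤ) * p, (p : ℤ)]).det = p := by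
    rw [Matrix.det_fin_two_of]; linear_combination (p : ℤ) * hmn
  have hp0 : (p : ℤ) ≠ 0 := by exact_mod_cast hp
  obtain ⟨l, hl⟩ := id hN
  have eg : g.1 = !![g.1 0 0, g.1 0 1; g.1 1 0, g.1 1 1] := Matrix.eta_fin_two _
  generalize ha : g.1 0 0 = a at *
  generalize hb : g.1 0 1 = b at *
  generalize hc : g.1 1 0 = c at *
  generalize hd : g.1 1 1 = d at *
  rw [eg]
  constructor
  · have e : !![a, b; c, d] * !![m * p, n; (N : ℤ) * p, (p : ℤ)] =
        !![m * p, n; (N : ℤ) * p, (p : ℤ)] *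
          !![a * m * p + b * N * p - n * c * m - n * d * N, a * n + b * p - n ^ 2 * k - n * d;
            p * (m * (c * m + d * N) - N * (a * m + b * N)),
            m * c * n + m * d * p - N * a * n - N * b * p] := by
      rw [Matrix.mul_fin_two, Matrix.mul_fin_two]
      apply fin_two_congr
      · linear_combination -(a * (m * p) + b * (N * p)) * hmn
      · linear_combination -(a * n + b * p) * hmn - m * n ^ 2 * hk
      · linear_combination -(c * (m * p) + d * (N * p)) * hmn
      · linear_combination -(c * n + d * p) * hmn - N * n ^ 2 * hk
    refine ⟨⟨!![_, _; _, _], ?_⟩, ⟨mem_of_Gamma1_le_of_diag_congr h1 hg.1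
      (hc ▸ hN) ?_ ?_ ?_, ?_⟩, e⟩
    · have := congrArg Matrix.det e
      rw [Matrix.det_mul, Matrix.det_mul, ← eg, g.2, hdX, one_mul] at this
      exact mul_left_cancel₀ hp0 (by rw [mul_one]; exact this.symm)
    · exact ⟨p * (m * (l * m + d) - (a * m + b * N)), by
        simp; linear_combination p * m ^ 2 * hl⟩
    · rw [ha]
      exact ⟨a * n + b * p - n * l * m - n * d, by
        simp; linear_combination a * hmn - n * m * hl⟩
    · rw [hd]
      exact ⟨m * l * n + d * n - a * n - b * p, by
        simp; linear_combination d * hmn + n * m * hl⟩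
    · exact Gamma0_mem.2 ((ZMod.intCast_zmod_eq_zero_iff_dvd _ _).2 (Dvd.intro _ rfl))
  · have e : !![m * p * a + n * c - N * (m * p * b + n * d),
            m * (m * p * b + n * d) - n * m * a - n ^ 2 * k;
            p * (N * a + k * p - N * (N * b + d)), m * (N * p * b + p * d) - n * (N * a + c)] *
          !![m * p, n; (N : ℤ) * p, (p : ℤ)] =
        !![m * p, n; (N : ℤ) * p, (p : ℤ)] * !![a, b; c, d] := by
      rw [Matrix.mul_fin_two, Matrix.mul_fin_two]
      apply fin_two_congr
      · linear_combination (m * p * a + n * c) * hmn + n ^ 2 * N * hk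
      · linear_combination (m * p * b + n * d) * hmn + n ^ 2 * hk
      · linear_combination (N * p * a + p * c) * hmn - m * p ^ 2 * hk
      · linear_combination (N * p * b + p * d) * hmn - n * p * hk
    refine ⟨⟨!![_, _; _, _], ?_⟩, ⟨mem_of_Gamma1_le_of_diag_congr h1 hg.1
      (hc ▸ hN) ?_ ?_ ?_, ?_⟩, e⟩
    · have := congrArg Matrix.det e
      rw [Matrix.det_mul, Matrix.det_mul, ← eg, g.2, hdX, mul_one] at this
      exact mul_right_cancel₀ hp0 (by rw [one_mul]; exact this)
    · exact ⟨p * (a + l - (N * b + d)), by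
        simp; linear_combination p * hl - p * hk⟩
    · rw [ha]
      exact ⟨n * a + n * l - (m * p * b + n * d), by
        simp; linear_combination a * hmn + n * hl⟩
    · rw [hd]
      exact ⟨m * p * b + n * d - n * a - n * l, by
        simp; linear_combination d * hmn - n * hl⟩
    · exact Gamma0_mem.2 ((ZMod.intCast_zmod_eq_zero_iff_dvd _ _).2 (Dvd.intro _ rfl))

theorem stmt15 (p N : ℕ) (hp : p.Prime) (hN : 1 ≤ N) (hpN : ¬ p ∣ N)
    (Γ : Subgroup SL2Z) (h1 : Gamma1 N ≤ Γ) (h2 : Γ ≤ Gamma0 N)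
    (m n : ℤ) (hmn : m * p - n * N = 1)
    (Xm : Matrix (Fin 2) (Fin 2) ℤ)
    (hX : Xm = !![m, n; (N : ℤ), (p : ℤ)] * !![(p : ℤ), 0; 0, 1]) :
    (∀ g ∈ Γ ⊓ Gamma0 p, ∃ g' ∈ Γ ⊓ Gamma0 p,
        (g : SL2Z).1 * Xm = Xm * (g' : SL2Z).1) ∧
    (∃ σ : ↥(Γ ⊓ Gamma0 p) ≃ ↥(Γ ⊓ Gamma0 p),
        ∀ g : ↥(Γ ⊓ Gamma0 p), ((g : SL2Z)).1 * Xm = Xm * ((σ g : SL2Z)).1) ∧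
    {x : Matrix (Fin 2) (Fin 2) ℤ | ∃ g ∈ Γ ⊓ Gamma0 p, ∃ h ∈ Γ ⊓ Gamma0 p,
        x = (g : SL2Z).1 * Xm * (h : SL2Z).1}
      = {x : Matrix (Fin 2) (Fin 2) ℤ | ∃ g ∈ Γ ⊓ Gamma0 p, x = (g : SL2Z).1 * Xm} := by
  have hX' : Xm = !![m * p, n; (N : ℤ) * p, (p : ℤ)] := by
    rw [hX, Matrix.mul_fin_two]
    apply fin_two_congr <;> ring
  have key {g : SL2Z} (hg : g ∈ Γ ⊓ Gamma0 p) :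
      (∃ g' ∈ Γ ⊓ Gamma0 p, g.1 * Xm = Xm * g'.1) ∧
      (∃ g' ∈ Γ ⊓ Gamma0 p, g'.1 * Xm = Xm * g.1) :=
    hX' ▸ exists_mul_eq_mul_of_mem hp.ne_zero h1 h2 hmn hg
  have hdet : Xm.det ≠ 0 := by
    have : Xm.det = p := by
      rw [hX', Matrix.det_fin_two_of]; linear_combination (p : ℤ) * hmn
    rw [this]; exact_mod_cast hp.ne_zero
  have cancel_left {A B : SL2Z} (h : Xm * A.1 = Xm * B.1) : A = B := by
    have := congrArg (Xm.adjugate * ·) h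
    simp only [← Matrix.mul_assoc, Matrix.adjugate_mul, Matrix.smul_mul, Matrix.one_mul] at this
    exact Subtype.ext (smul_right_injective _ hdet this)
  have cancel_right {A B : SL2Z} (h : A.1 * Xm = B.1 * Xm) : A = B := by
    have := congrArg (· * Xm.adjugate) h
    simp only [Matrix.mul_assoc, Matrix.mul_adjugate, Matrix.mul_smul, Matrix.mul_one] at this
    exact Subtype.ext (smul_right_injective _ hdet this)
  refine ⟨fun g hg => (key hg).1, ?_, ?_⟩
  · choose f hf hfX using fun g : ↥(Γ ⊓ Gamma0 p) => (key g.2).1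
    refine ⟨Equiv.ofBijective (fun g => ⟨f g, hf g⟩) ⟨fun g h hgh => ?_, fun g => ?_⟩, hfX⟩
    · have e : f g = f h := congrArg Subtype.val hgh
      exact Subtype.ext (cancel_right (by rw [hfX, hfX, e]))
    · obtain ⟨g', hg', e⟩ := (key g.2).2
      exact ⟨⟨g', hg'⟩, Subtype.ext (cancel_left ((hfX _).symm.trans e))⟩
  · ext x
    constructor
    · rintro ⟨g, hg, h, hh, rfl⟩
      obtain ⟨h', hh', e⟩ := (key hh).2
      exact ⟨g * h', mul_mem hg hh', by
        rw [Matrix.mul_assoc, ← e, ← Matrix.mul_assoc]; rfl⟩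
    · rintro ⟨g, hg, rfl⟩
      exact ⟨g, hg, 1, one_mem _, (Matrix.mul_one _).symm⟩
end
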